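/- Let J ∈ ℂ^{m×m} with J = J* = J^{−1}, and H : [a,b] → ℂ^{m×m} continuous with H(x) positive semidefinite. Let B ∈ ℂ^{n×n} with B − x I_n invertible for all x ∈ [a,b], A(x) = (B − x I_n)^{−1}, and let Π : [a,b] → ℂ^{n×m}, S : [a,b] → ℂ^{n×n} be differentiable satisfying Π_x = −i A Π J H and S_x = Π J H J* Π* − (A S + S A*) on [a,b], with S(a) = S(a)* and A(a)S(a) − S(a)A(a)* = i Π(a) J Π(a)*. If S(a) is positive definite, then S(x) is positive definite for every x ∈ [a,b] and sup_{x∈[a,b]} ‖S(x)^{−1}‖ < ∞. -/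

import Mathlib

open Matrix
open scoped ComplexOrder

attribute [local instance] Matrix.normedAddCommGroup Matrix.normedSpace

section Calculus

variable {l m n : ℕ} {x : ℝ}

theorem HasDerivAt.matrix_mul {P : ℝ → Matrix (Fin l) (Fin m) ℂ} {Q : ℝ → Matrix (Fin m) (Fin n) ℂ}
    {P' : Matrix (Fin l) (Fin m) ℂ} {Q' : Matrix (Fin m) (Fin n) ℂ}
    (hP : HasDerivAt P P' x) (hQ : HasDerivAt Q Q' x) :
    HasDerivAt (fun t ↦ P t * Q t) (P' * Q x + P x * Q') x := by
  refine hasDerivAt_pi.2 fun i ↦ hasDerivAt_pi.2 fun j ↦ ?_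
  simp only [mul_apply, Matrix.add_apply, ← Finset.sum_add_distrib]
  exact HasDerivAt.fun_sum fun k _ ↦
    (hasDerivAt_pi.1 (hasDerivAt_pi.1 hP i) k).mul (hasDerivAt_pi.1 (hasDerivAt_pi.1 hQ k) j)

theorem HasDerivAt.matrix_conjTranspose {P : ℝ → Matrix (Fin m) (Fin n) ℂ}
    {P' : Matrix (Fin m) (Fin n) ℂ} (hP : HasDerivAt P P' x) :
    HasDerivAt (fun t ↦ (P t)ᴴ) P'ᴴ x :=
  hasDerivAt_pi.2 fun i ↦ hasDerivAt_pi.2 fun j ↦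
    (hasDerivAt_pi.1 (hasDerivAt_pi.1 hP j) i).star

theorem HasDerivAt.ringInverse {R : Type*} [NormedRing R] [NormedAlgebra ℝ R]
    [FiniteDimensional ℝ R] {f : ℝ → R} {f' : R} (hx : IsUnit (f x)) (hf : HasDerivAt f f' x) :
    HasDerivAt (fun t ↦ Ring.inverse (f t))
      (-(Ring.inverse (f x) * f' * Ring.inverse (f x))) x := by
  have : CompleteSpace R := FiniteDimensional.complete ℝ R
  obtain ⟨u, hu⟩ := hx
  have h := hasFDerivAt_ringInverse (𝕜 := ℝ) u
  rw [hu] at h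
  exact (h.comp_hasDerivAt x hf).congr_deriv (by simp [← hu])

/-- The resolvent `x ↦ (B - x)⁻¹` is differentiable with derivative its square. -/
theorem hasDerivAt_resolvent {B : Matrix (Fin n) (Fin n) ℂ}
    (hB : IsUnit (B - (x : ℂ) • (1 : Matrix (Fin n) (Fin n) ℂ))) :
    HasDerivAt (fun t : ℝ ↦ (B - (t : ℂ) • (1 : Matrix (Fin n) (Fin n) ℂ))⁻¹)
      ((B - (x : ℂ) • (1 : Matrix (Fin n) (Fin n) ℂ))⁻¹ *
        (B - (x : ℂ) • (1 : Matrix (Fin n) (Fin n) ℂ))⁻¹) x := by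
  have h1 : HasDerivAt (fun t : ℝ ↦ B - (t : ℂ) • (1 : Matrix (Fin n) (Fin n) ℂ))
      (-((1 : ℂ) • (1 : Matrix (Fin n) (Fin n) ℂ))) x :=
    (((hasDerivAt_id x).ofReal_comp).smul_const _).const_sub B
  let := Matrix.linftyOpNormedRing (n := Fin n) (α := ℂ)
  let := Matrix.linftyOpNormedAlgebra (R := ℝ) (n := Fin n) (α := ℂ)
  have h := HasDerivAt.ringInverse hB h1
  simp only [nonsing_inv_eq_ringInverse]
  exact h.congr_deriv (by simp)

end Calculus

/-- A matrix function on `[a, b]` with positive semidefinite derivative is monotone in the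
Loewner order. -/
theorem posSemidef_sub_of_hasDerivAt {n : ℕ} {a b : ℝ} {T T' : ℝ → Matrix (Fin n) (Fin n) ℂ}
    (hT : ∀ x ∈ Set.Icc a b, HasDerivAt T (T' x) x)
    (hT' : ∀ x ∈ Set.Icc a b, (T' x).PosSemidef) (ha : (T a).IsHermitian)
    {x : ℝ} (hx : x ∈ Set.Icc a b) : (T x - T a).PosSemidef := by
  have hherm : (T x).IsHermitian := by
    have hd : ∀ y ∈ Set.Icc a b, HasDerivAt (fun t ↦ T t - (T t)ᴴ) 0 y := fun y hy ↦ by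
      have h := (hT y hy).fun_sub (hT y hy).matrix_conjTranspose
      rwa [(hT' y hy).isHermitian.eq, sub_self] at h
    have := constant_of_has_deriv_right_zero
      (fun y hy ↦ (hd y hy).continuousAt.continuousWithinAt)
      (fun y hy ↦ (hd y (Set.Ico_subset_Icc_self hy)).hasDerivWithinAt) x hx
    rw [ha.eq, sub_self, sub_eq_zero] at this
    exact this.symm
  have hsub := hherm.sub ha
  refine .of_dotProduct_mulVec_nonneg hsub fun v ↦ ?_
  have hq : ∀ y ∈ Set.Icc a b, HasDerivAt (fun t ↦ (star v ⬝ᵥ (T t *ᵥ v)).re)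
      (star v ⬝ᵥ (T' y *ᵥ v)).re y := fun y hy ↦ by
    refine Complex.reCLM.hasFDerivAt.comp_hasDerivAt y
      (HasDerivAt.fun_sum fun i _ ↦ HasDerivAt.const_mul _ ?_)
    refine HasDerivAt.fun_sum (u := Finset.univ) (A := fun j t ↦ T t i j * v j) (A' := fun j ↦ T' y i j * v j)
      fun j _ ↦ ?_
    exact (hasDerivAt_pi.1 (hasDerivAt_pi.1 (hT y hy) i) j).mul_const _
  have hmono : MonotoneOn (fun t ↦ (star v ⬝ᵥ (T t *ᵥ v)).re) (Set.Icc a b) :=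
    monotoneOn_of_hasDerivWithinAt_nonneg (convex_Icc a b)
      (fun y hy ↦ (hq y hy).continuousAt.continuousWithinAt)
      (fun y hy ↦ (hq y (interior_subset hy)).hasDerivWithinAt)
      (fun y hy ↦ ((Complex.le_def.1 <|
        (hT' y (interior_subset hy)).dotProduct_mulVec_nonneg v).1))
  have hle := hmono (Set.left_mem_Icc.2 (hx.1.trans hx.2)) hx hx.1
  refine Complex.le_def.2 ⟨?_, (hsub.im_star_dotProduct_mulVec_self v).symm⟩
  simpa [sub_mulVec, dotProduct_sub] using hle

/-- Proposition 2.2: positivity of `S(a)` propagates along the GBDT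
evolution equations, and `‖S(x)⁻¹‖` is uniformly bounded on `[a,b]`. -/
theorem stmt_7 {m n : ℕ} (a b : ℝ) (hab : a ≤ b)
    (J : Matrix (Fin m) (Fin m) ℂ) (hJherm : Jᴴ = J) (hJinv : J * J = 1)
    (H : ℝ → Matrix (Fin m) (Fin m) ℂ) (hHcont : ContinuousOn H (Set.Icc a b))
    (hHpos : ∀ x ∈ Set.Icc a b, (H x).PosSemidef)
    (B : Matrix (Fin n) (Fin n) ℂ)
    (hB : ∀ x ∈ Set.Icc a b,
      IsUnit (B - (x : ℂ) • (1 : Matrix (Fin n) (Fin n) ℂ)))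
    (Φ : ℝ → Matrix (Fin n) (Fin m) ℂ) (S : ℝ → Matrix (Fin n) (Fin n) ℂ)
    (hΦ : ∀ x ∈ Set.Icc a b, HasDerivAt Φ
      (-(Complex.I • ((B - (x : ℂ) • (1 : Matrix (Fin n) (Fin n) ℂ))⁻¹ *
        Φ x * J * H x))) x)
    (hS : ∀ x ∈ Set.Icc a b, HasDerivAt S
      (Φ x * J * H x * Jᴴ * (Φ x)ᴴ -
        ((B - (x : ℂ) • (1 : Matrix (Fin n) (Fin n) ℂ))⁻¹ * S x +
          S x * ((B - (x : ℂ) • (1 : Matrix (Fin n) (Fin n) ℂ))⁻¹)ᴴ)) x)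
    (hSa : S a = (S a)ᴴ)
    (hid : (B - (a : ℂ) • (1 : Matrix (Fin n) (Fin n) ℂ))⁻¹ * S a -
        S a * ((B - (a : ℂ) • (1 : Matrix (Fin n) (Fin n) ℂ))⁻¹)ᴴ =
      Complex.I • (Φ a * J * (Φ a)ᴴ))
    (hSapos : (S a).PosDef) :
    (∀ x ∈ Set.Icc a b, (S x).PosDef) ∧
      ∃ C : ℝ, ∀ x ∈ Set.Icc a b, ‖(S x)⁻¹‖ ≤ C := by
  have hpos : ∀ x ∈ Set.Icc a b, (S x).PosDef := by
    intro x hx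
    set A : ℝ → Matrix (Fin n) (Fin n) ℂ :=
      fun t ↦ (B - (t : ℂ) • (1 : Matrix (Fin n) (Fin n) ℂ))⁻¹ with hA
    have hAu : ∀ y ∈ Set.Icc a b, IsUnit (A y) := fun y hy ↦ by
      rw [hA, Matrix.isUnit_nonsing_inv_iff]
      exact hB y hy
    have hconj : ∀ y ∈ Set.Icc a b, ((A y * S y * (A y)ᴴ).PosDef ↔ (S y).PosDef) :=
      fun y hy ↦ (hAu y hy).posDef_star_right_conjugate_iff
    have hderiv : ∀ y ∈ Set.Icc a b, HasDerivAt (fun t ↦ A t * S t * (A t)ᴴ)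
        ((A y * (Φ y * J)) * H y * (A y * (Φ y * J))ᴴ) y := fun y hy ↦ by
      have hAd : HasDerivAt A (A y * A y) y := hasDerivAt_resolvent (hB y hy)
      convert (hAd.matrix_mul (hS y hy)).matrix_mul hAd.matrix_conjTranspose using 1
      simp only [conjTranspose_mul]
      change _ = (A y * A y * S y + A y * (_ - (A y * S y + S y * (A y)ᴴ))) * (A y)ᴴ + _
      simp only [mul_sub, sub_mul, mul_add, add_mul, Matrix.mul_assoc]
      abel
    have ha := Set.left_mem_Icc.2 hab
    have hTa := (hconj a ha).2 hSapos
    have hmono := posSemidef_sub_of_hasDerivAt hderiv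
      (fun y hy ↦ (hHpos y hy).mul_mul_conjTranspose_same _) hTa.isHermitian hx
    rw [← hconj x hx]
    simpa using hTa.add_posSemidef hmono
  refine ⟨hpos, isCompact_Icc.exists_bound_of_continuousOn fun x hx ↦ ?_⟩
  have hdet : (S x).det ≠ 0 := (hpos x hx).det_pos.ne'
  have hinv : ContinuousAt (fun M : Matrix (Fin n) (Fin n) ℂ ↦ M⁻¹) (S x) := by
    refine continuousAt_matrix_inv _ ?_
    rw [Ring.inverse_eq_inv']
    exact continuousAt_inv₀ hdet
  exact (hinv.comp (hS x hx).continuousAt).continuousWithinAt
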